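/- Let I, J be admissible ideals on ℕ. Then the multiplier set m(c₀(I) ∩ ℓ∞, c₀(J) ∩ ℓ∞) equals {s ∈ ℓ∞ : for every E ∈ I, the sequence (s_n · 1_E(n))_n J-converges to 0}. -/

import Mathlib

open Filter Topology

/-- `x ∈ ℓ∞`: `x` is a bounded real sequence. -/
def Bdd (x : ℕ → ℝ) : Prop := ∃ C : ℝ, ∀ n, |x n| ≤ C

/-- An admissible ideal on `ℕ`: a family of subsets of `ℕ` closed under taking
subsets and finite unions, containing every finite set, and not containing `ℕ`. -/
def IsAdmissibleIdeal (I : Set (Set ℕ)) : Prop :=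
  (∀ A ∈ I, ∀ B ⊆ A, B ∈ I) ∧
  (∀ A ∈ I, ∀ B ∈ I, A ∪ B ∈ I) ∧
  (∀ A : Set ℕ, A.Finite → A ∈ I) ∧
  (Set.univ : Set ℕ) ∉ I

/-- `I`-convergence of the sequence `x` to `η`. -/
def IdealLim (I : Set (Set ℕ)) (x : ℕ → ℝ) (η : ℝ) : Prop :=
  ∀ ε : ℝ, 0 < ε → {n : ℕ | ε < |x n - η|} ∈ I

/-- `(Ax)ₙ = ∑ₖ a n k * x k`. -/
noncomputable def matMul (a : ℕ → ℕ → ℝ) (x : ℕ → ℝ) : ℕ → ℝ :=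
  fun n => ∑' k, a n k * x k

/-- Condition (T1): `sup_n ∑ₖ |a n k| < ∞`. -/
def CondT1 (a : ℕ → ℕ → ℝ) : Prop :=
  ∃ C : ℝ, ∀ n : ℕ, ∀ F : Finset ℕ, ∑ k ∈ F, |a n k| ≤ C

/-- Condition (T2): the rows of `a` are summable and `J-lim_n ∑ₖ a n k = 1`. -/
def CondT2 (J : Set (Set ℕ)) (a : ℕ → ℕ → ℝ) : Prop :=
  (∀ n, Summable (a n)) ∧ IdealLim J (fun n => ∑' k, a n k) 1

/-- Condition (T3): `J-lim_n ∑_{k ∈ E} |a n k| = 0` for every `E ∈ I`. -/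
def CondT3 (I J : Set (Set ℕ)) (a : ℕ → ℕ → ℝ) : Prop :=
  ∀ E ∈ I, IdealLim J (fun n => ∑' k, E.indicator (fun j => |a n j|) k) 0

/-- `A` is `(I, J)`-regular: `A` maps every bounded `I`-convergent sequence to a
(well-defined) bounded `J`-convergent sequence and preserves the ideal limits. -/
def IJRegular (I J : Set (Set ℕ)) (a : ℕ → ℕ → ℝ) : Prop :=
  ∀ x : ℕ → ℝ, Bdd x → ∀ η : ℝ, IdealLim I x η →
    (∀ n, Summable fun k => a n k * x k) ∧ Bdd (matMul a x) ∧
      IdealLim J (matMul a x) η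

/-- The ideal `Z` of sets of asymptotic density zero. -/
def densityZeroIdeal : Set (Set ℕ) :=
  {S : Set ℕ | Tendsto
    (fun n : ℕ => (∑ k ∈ Finset.Icc 1 n, S.indicator (fun _ => (1 : ℝ)) k) / n)
    atTop (𝓝 0)}

/-- A sequence which multiplies every null sequence to a bounded sequence is bounded. -/
theorem bdd_of_forall_tendsto_zero {s : ℕ → ℝ}
    (h : ∀ x : ℕ → ℝ, Tendsto x atTop (𝓝 0) → Bdd (fun n => s n * x n)) : Bdd s := by
  by_contra hs
  set M : ℕ → ℝ := fun n => partialSups (fun n => |s n|) n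
  have hsM : ∀ n, |s n| ≤ M n := fun n => le_partialSups (fun n => |s n|) n
  have hM0 : ∀ n, 0 ≤ M n := fun n => (abs_nonneg _).trans (hsM n)
  have hmono : Monotone M := fun _ _ hab => (partialSups fun n => |s n|).monotone hab
  have htop : Tendsto M atTop atTop := by
    refine tendsto_atTop_atTop_of_monotone hmono fun b => ?_
    by_contra! hb
    exact hs ⟨b, fun n => (hsM n).trans (hb n).le⟩
  have hx : Tendsto (fun n => (√(1 + M n))⁻¹) atTop (𝓝 0) :=
    tendsto_inv_atTop_zero.comp
      (Real.tendsto_sqrt_atTop.comp (tendsto_atTop_add_const_left _ 1 htop))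
  obtain ⟨C, hC⟩ := h _ hx
  have hpos : ∀ n, 0 < √(1 + M n) := fun n => Real.sqrt_pos.2 (by linarith [hM0 n])
  have hC0 : 0 ≤ C := (abs_nonneg _).trans (hC 0)
  have hle : ∀ n, |s n| ≤ C * √(1 + M n) := fun n => by
    have := hC n
    rwa [abs_mul, abs_inv, abs_of_pos (hpos n), ← div_eq_mul_inv, div_le_iff₀ (hpos n)] at this
  have hMle : ∀ n, M n ≤ C * √(1 + M n) := fun n =>
    partialSups_le _ _ _ fun i hi => (hle i).trans <| by
      have := hmono hi
      gcongr
  refine hs ⟨C ^ 2 + 1, fun n => (hsM n).trans ?_⟩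
  have hsq : √(1 + M n) ^ 2 = 1 + M n := Real.sq_sqrt (by linarith [hM0 n])
  have h2 : M n ^ 2 ≤ C ^ 2 * (1 + M n) := by
    rw [← hsq, ← mul_pow]
    exact pow_le_pow_left₀ (hM0 n) (hMle n) 2
  by_contra! hlt
  nlinarith [sq_nonneg C]

/-- A convergent sequence converges to the same limit along every admissible ideal. -/
theorem IsAdmissibleIdeal.idealLim_of_tendsto {I : Set (Set ℕ)} (hI : IsAdmissibleIdeal I)
    {x : ℕ → ℝ} {η : ℝ} (hx : Tendsto x atTop (𝓝 η)) : IdealLim I x η := by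
  intro ε hε
  obtain ⟨N, hN⟩ := Metric.tendsto_atTop.1 hx ε hε
  refine hI.2.2.1 _ ((Set.finite_lt_nat N).subset fun n hn => ?_)
  by_contra h
  have := hN n (not_lt.1 h)
  rw [Real.dist_eq] at this
  exact lt_asymm this hn

/-- A convergent real sequence is bounded. -/
theorem Bdd.of_tendsto {x : ℕ → ℝ} {η : ℝ} (hx : Tendsto x atTop (𝓝 η)) : Bdd x := by
  obtain ⟨C, hC⟩ := hx.abs.bddAbove_range
  exact ⟨C, fun n => hC ⟨n, rfl⟩⟩

/-- The multiplier set `m(c₀(I) ∩ ℓ∞, c₀(J) ∩ ℓ∞)` equals the set of bounded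
sequences `s` such that `s · 1_E` `J`-converges to `0` for every `E ∈ I`. -/
theorem multiplier_eq (I J : Set (Set ℕ))
    (hI : IsAdmissibleIdeal I) (hJ : IsAdmissibleIdeal J) :
    {s : ℕ → ℝ | ∀ x : ℕ → ℝ, Bdd x → IdealLim I x 0 →
        Bdd (fun n => s n * x n) ∧ IdealLim J (fun n => s n * x n) 0} =
      {s : ℕ → ℝ | Bdd s ∧ ∀ E ∈ I,
        IdealLim J (fun n => s n * E.indicator (fun _ => (1 : ℝ)) n) 0} := by
  ext s
  constructor
  · intro h
    refine ⟨bdd_of_forall_tendsto_zero fun x hx =>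
      (h x (.of_tendsto hx) (hI.idealLim_of_tendsto hx)).1, fun E hE => (h _ ⟨1, ?_⟩ ?_).2⟩
    · intro n
      by_cases hn : n ∈ E <;> simp [hn]
    · refine fun ε hε => hI.1 E hE _ fun n hn => ?_
      by_contra hnE
      simp only [Set.mem_ofPred_eq, Set.indicator_of_notMem hnE, sub_zero, abs_zero] at hn
      exact lt_asymm hε hn
  · rintro ⟨⟨C, hC⟩, h⟩ x ⟨D, hD⟩ hx
    have hC0 : 0 ≤ C := (abs_nonneg _).trans (hC 0)
    have hD0 : 0 ≤ D := (abs_nonneg _).trans (hD 0)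
    refine ⟨⟨C * D, fun n => ?_⟩, fun ε hε => ?_⟩
    · rw [abs_mul]
      exact mul_le_mul (hC n) (hD n) (abs_nonneg _) hC0
    · refine hJ.1 _ (h _ (hx (ε / (C + 1)) (by positivity)) (ε / (D + 1)) (by positivity)) _
        fun n hn => ?_
      simp only [Set.mem_ofPred_eq, sub_zero, abs_mul] at hn ⊢
      have hxn : ε / (C + 1) < |x n| := by
        rw [div_lt_iff₀ (by positivity)]
        by_contra! hle
        have := mul_le_mul_of_nonneg_right (hC n) (abs_nonneg (x n))
        nlinarith [abs_nonneg (x n)]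
      rw [Set.indicator_of_mem (by exact hxn), abs_one, mul_one, div_lt_iff₀ (by positivity)]
      have := mul_le_mul_of_nonneg_left (hD n) (abs_nonneg (s n))
      nlinarith [abs_nonneg (s n)]
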